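/- Let R be a finite commutative ring with identity, let A ∈ M_{s×s}(R) satisfy AA^T = Diag(r_1,…,r_s) with each r_i a unit of R, and let C_1,…,C_s be free linear codes over R of the same length n. Then the matrix-product code [C_1 … C_s]A is a linear complementary dual (LCD) code if and only if C_i is LCD for every i = 1,…,s. -/

import Mathlib

open Matrix BigOperators

noncomputable section

/-- The linear map sending a tuple of codewords `(c_1, …, c_s)` (each in `R^n`)
to the `n × l` matrix `(c_1 … c_s) A`. -/
def mpcMap {R : Type*} [CommRing R] {s l n : ℕ} (A : Matrix (Fin s) (Fin l) R) :
    (Fin s → Fin n → R) →ₗ[R] Matrix (Fin n) (Fin l) R where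
  toFun c := Matrix.of fun p t => ∑ i, c i p * A i t
  map_add' x y := by
    ext p t
    simp [add_mul, Finset.sum_add_distrib]
  map_smul' r x := by
    ext p t
    simp [Finset.mul_sum, mul_assoc]

/-- The matrix-product code `[C_1 … C_s] A`, viewed as a linear code of length `n·l`
inside `M_{n×l}(R)`. -/
def matrixProductCode {R : Type*} [CommRing R] {s l n : ℕ}
    (C : Fin s → Submodule R (Fin n → R)) (A : Matrix (Fin s) (Fin l) R) :
    Submodule R (Matrix (Fin n) (Fin l) R) :=
  (Submodule.pi Set.univ C).map (mpcMap A)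

/-- The (Euclidean) dual of a linear code `C ⊆ R^ι`. -/
def dualCode {R : Type*} [CommRing R] {ι : Type*} [Fintype ι] (C : Submodule R (ι → R)) :
    Submodule R (ι → R) where
  carrier := {x | ∀ y ∈ C, ∑ i, x i * y i = 0}
  add_mem' := by
    intro a b ha hb y hy
    simp only [Set.mem_setOf_eq] at ha hb
    simp [Pi.add_apply, add_mul, Finset.sum_add_distrib, ha y hy, hb y hy]
  zero_mem' := by intro y hy; simp
  smul_mem' := by
    intro r a ha y hy
    simp only [Set.mem_setOf_eq] at ha
    simp [Pi.smul_apply, smul_eq_mul, mul_assoc, ← Finset.mul_sum, ha y hy]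

/-- The dual of a code of `n × l` matrices, w.r.t. `⟨X,Y⟩ = tr (X Yᵀ) = ∑ᵢⱼ Xᵢⱼ Yᵢⱼ`. -/
def dualCodeMat {R : Type*} [CommRing R] {n l : ℕ}
    (C : Submodule R (Matrix (Fin n) (Fin l) R)) :
    Submodule R (Matrix (Fin n) (Fin l) R) where
  carrier := {x | ∀ y ∈ C, ∑ i, ∑ j, x i j * y i j = 0}
  add_mem' := by
    intro a b ha hb y hy
    simp only [Set.mem_setOf_eq] at ha hb
    simp [Matrix.add_apply, add_mul, Finset.sum_add_distrib, ha y hy, hb y hy]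
  zero_mem' := by intro y hy; simp
  smul_mem' := by
    intro r a ha y hy
    simp only [Set.mem_setOf_eq] at ha
    simp [Matrix.smul_apply, smul_eq_mul, mul_assoc, ← Finset.mul_sum, ha y hy]

/-- The minimum Hamming distance of a (linear) code `C ⊆ R^ι`:
the minimal Hamming weight of a nonzero codeword. -/
def minDist {R : Type*} [Zero R] [DecidableEq R] {ι : Type*} [Fintype ι]
    (C : Set (ι → R)) : ℕ :=
  sInf (hammingNorm '' {c ∈ C | c ≠ 0})

/-- The Hamming weight of an `n × l` matrix: the number of its nonzero entries. -/
def matWt {R : Type*} [Zero R] [DecidableEq R] {n l : ℕ}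
    (x : Matrix (Fin n) (Fin l) R) : ℕ :=
  hammingNorm fun p : Fin n × Fin l => x p.1 p.2

/-- The minimum Hamming distance of a code of `n × l` matrices
(regarded as words of length `n·l`). -/
def minDistMat {R : Type*} [Zero R] [DecidableEq R] {n l : ℕ}
    (C : Set (Matrix (Fin n) (Fin l) R)) : ℕ :=
  sInf (matWt '' {c ∈ C | c ≠ 0})

end

noncomputable section

/-- `rowSpanCode A i` is the submodule `C_{L_i}` of `R^l` generated by the rows
`L_1, …, L_i` of `A` (in 0-indexed terms, the rows `A j` with `j ≤ i`). -/
def rowSpanCode {R : Type*} [CommRing R] {s l : ℕ} (A : Matrix (Fin s) (Fin l) R)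
    (i : Fin s) : Submodule R (Fin l → R) :=
  Submodule.span R ((fun j => A j) '' {j : Fin s | j ≤ i})

end

theorem mpcMap_eq_mul {R : Type*} [CommRing R] {s l n : ℕ} (A : Matrix (Fin s) (Fin l) R)
    (c : Fin s → Fin n → R) : mpcMap A c = (Matrix.of c)ᵀ * A := by
  ext p t
  simp [mpcMap, Matrix.mul_apply]

theorem mpcMap_mul_transpose_mpcMap {R : Type*} [CommRing R] {s l n : ℕ}
    {A : Matrix (Fin s) (Fin l) R} {r : Fin s → R} (hA : A * Aᵀ = Matrix.diagonal r)
    (c d : Fin s → Fin n → R) :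
    mpcMap A c * (mpcMap A d)ᵀ = (Matrix.of c)ᵀ * Matrix.diagonal r * Matrix.of d := by
  rw [mpcMap_eq_mul, mpcMap_eq_mul, Matrix.transpose_mul, Matrix.transpose_transpose, ← hA]
  simp only [Matrix.mul_assoc]

/-- If the rows of `A` are pairwise orthogonal, the inner product of two codewords is the weighted
sum of the inner products of their components. -/
theorem sum_mpcMap_mul_mpcMap {R : Type*} [CommRing R] {s l n : ℕ}
    {A : Matrix (Fin s) (Fin l) R} {r : Fin s → R} (hA : A * Aᵀ = Matrix.diagonal r)
    (c d : Fin s → Fin n → R) :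
    ∑ p, ∑ t, mpcMap A c p t * mpcMap A d p t = ∑ i, r i * ∑ p, c i p * d i p := by
  have h (p : Fin n) : ∑ t, mpcMap A c p t * mpcMap A d p t = ∑ i, r i * (c i p * d i p) := by
    have := congrFun (congrFun (mpcMap_mul_transpose_mpcMap hA c d) p) p
    rw [Matrix.mul_apply, Matrix.mul_apply] at this
    simp only [Matrix.transpose_apply, Matrix.mul_diagonal, Matrix.of_apply] at this
    rw [this]
    exact Finset.sum_congr rfl fun i _ => by ring
  simp only [h, Finset.mul_sum]
  exact Finset.sum_comm

theorem mpcMap_injective {R : Type*} [CommRing R] {s l n : ℕ}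
    {A : Matrix (Fin s) (Fin l) R} {r : Fin s → R} (hr : ∀ i, IsUnit (r i))
    (hA : A * Aᵀ = Matrix.diagonal r) :
    Function.Injective (mpcMap (n := n) A) := by
  rw [← LinearMap.ker_eq_bot, LinearMap.ker_eq_bot']
  intro c hc
  rw [mpcMap_eq_mul] at hc
  have h : (Matrix.of c)ᵀ * Matrix.diagonal r = 0 := by
    rw [← hA, ← Matrix.mul_assoc, hc, Matrix.zero_mul]
  ext i p
  have hip := congrFun (congrFun h p) i
  rw [Matrix.mul_diagonal] at hip
  exact (hr i).mul_left_eq_zero.mp hip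

theorem mpcMap_mem_dualCodeMat_iff {R : Type*} [CommRing R] {s l n : ℕ}
    {A : Matrix (Fin s) (Fin l) R} {r : Fin s → R} (hr : ∀ i, IsUnit (r i))
    (hA : A * Aᵀ = Matrix.diagonal r) (C : Fin s → Submodule R (Fin n → R))
    (c : Fin s → Fin n → R) :
    mpcMap A c ∈ dualCodeMat (matrixProductCode C A) ↔ ∀ i, c i ∈ dualCode (C i) := by
  constructor
  · intro h i y hy
    have h0 := h _ (Submodule.mem_map_of_mem (Submodule.le_comap_single_pi C hy))
    rw [LinearMap.single_apply, sum_mpcMap_mul_mpcMap hA, Finset.sum_eq_single i] at h0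
    · simpa using (hr i).mul_right_eq_zero.mp h0
    · intro j _ hj
      simp [Pi.single_eq_of_ne hj]
    · simp
  · rintro h _ ⟨d, hd, rfl⟩
    rw [sum_mpcMap_mul_mpcMap hA]
    exact Finset.sum_eq_zero fun i _ => by rw [h i (d i) (hd i trivial), mul_zero]

/-- The hull of a matrix-product code is the matrix-product code of the hulls. -/
theorem matrixProductCode_inf_dualCodeMat {R : Type*} [CommRing R] {s l n : ℕ}
    {A : Matrix (Fin s) (Fin l) R} {r : Fin s → R} (hr : ∀ i, IsUnit (r i))
    (hA : A * Aᵀ = Matrix.diagonal r) (C : Fin s → Submodule R (Fin n → R)) :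
    matrixProductCode C A ⊓ dualCodeMat (matrixProductCode C A) =
      matrixProductCode (fun i => C i ⊓ dualCode (C i)) A := by
  ext x
  constructor
  · rintro ⟨⟨c, hc, rfl⟩, hx⟩
    have hx' := (mpcMap_mem_dualCodeMat_iff hr hA C c).mp hx
    exact ⟨c, fun i hi => ⟨hc i hi, hx' i⟩, rfl⟩
  · rintro ⟨c, hc, rfl⟩
    exact ⟨⟨c, fun i hi => (hc i hi).1, rfl⟩,
      (mpcMap_mem_dualCodeMat_iff hr hA C c).mpr fun i => (hc i trivial).2⟩

theorem matrixProductCode_eq_bot_iff {R : Type*} [CommRing R] {s l n : ℕ}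
    {A : Matrix (Fin s) (Fin l) R} (hA : Function.Injective (mpcMap (n := n) A))
    {C : Fin s → Submodule R (Fin n → R)} :
    matrixProductCode C A = ⊥ ↔ ∀ i, C i = ⊥ := by
  rw [matrixProductCode, ← Submodule.map_bot (mpcMap A),
    (Submodule.map_injective_of_injective hA).eq_iff]
  simp only [Submodule.eq_bot_iff]
  constructor
  · intro h i y hy
    simpa using h _ (Submodule.le_comap_single_pi C hy)
  · intro h c hc
    exact funext fun i => h i _ (hc i trivial)

/-- Let `R` be a finite commutative ring and `A ∈ M_{s×s}(R)` with
`A Aᵀ = Diag(r_1, …, r_s)`, each `r_i` a unit, and let `C_1, …, C_s` be free linear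
codes of length `n` over `R`.  Then `[C_1 … C_s] A` is a linear complementary dual
(LCD) code if and only if every `C_i` is LCD. -/
theorem matrixProductCode_LCD_iff {R : Type*} [CommRing R] [Fintype R] {s n : ℕ}
    (A : Matrix (Fin s) (Fin s) R) (r : Fin s → R) (hr : ∀ i, IsUnit (r i))
    (hA : A * Aᵀ = Matrix.diagonal r)
    (C : Fin s → Submodule R (Fin n → R)) (hfree : ∀ i, Module.Free R (C i)) :
    matrixProductCode C A ⊓ dualCodeMat (matrixProductCode C A) = ⊥ ↔
      ∀ i, C i ⊓ dualCode (C i) = ⊥ := by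
  rw [matrixProductCode_inf_dualCodeMat hr hA,
    matrixProductCode_eq_bot_iff (mpcMap_injective hr hA)]
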